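/- For each σ ∈ {L,M,R}*L there exists a finite prefix w of the infinite word σ(0̄) such that, for every u ∈ {0,1}^ℕ with sup O(u) = sup₀(u), one has w·sup₀(σ(u)) = w·sup O(σ(u)) = σ(sup O(u)), where w·v denotes the concatenation of the finite word w with the infinite word v. -/

import Mathlib

/-- `π_β(u)` for a binary sequence `u = u₁u₂⋯` (indexed from 0). -/
noncomputable def piB (β : ℝ) (u : ℕ → Bool) : ℝ :=
  ∑' k : ℕ, (if u k then (1 : ℝ) else 0) / β ^ (k + 1)

/-- `π_β(u)` for a real digit sequence. -/
noncomputable def piR (β : ℝ) (u : ℕ → ℝ) : ℝ := ∑' k : ℕ, u k / β ^ (k + 1)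

/-- A binary sequence viewed as a real digit sequence. -/
def bR (u : ℕ → Bool) : ℕ → ℝ := fun k => if u k then 1 else 0

/-- `U_β(A)`: sequences with digits in `A` whose `π_β`-value has no other expansion over `A`. -/
def Uset (β : ℝ) (A : Set ℝ) : Set (ℕ → ℝ) :=
  {u | (∀ k, u k ∈ A) ∧ ∀ v : ℕ → ℝ, (∀ k, v k ∈ A) → v ≠ u → piR β v ≠ piR β u}

/-- `𝓛(m) = inf {β > 1 : U_β(m) ∩ {0,1}^ℕ is uncountable}`. -/
noncomputable def Lval (m : ℝ) : ℝ :=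
  sInf {β : ℝ | 1 < β ∧ ¬ (Uset β {0, 1, m} ∩ {v | ∃ u : ℕ → Bool, v = bR u}).Countable}

/-- The shift orbit `O(u)` of an infinite binary word. -/
def orbit (u : ℕ → Bool) : Set (ℕ → Bool) := {v | ∃ k : ℕ, v = fun i => u (i + k)}

/-- Suffixes of `u` preceded by the letter `1`. -/
def orbit1 (u : ℕ → Bool) : Set (ℕ → Bool) :=
  {v | ∃ k : ℕ, u k = true ∧ v = fun i => u (i + k + 1)}

/-- Suffixes of `u` preceded by the letter `0`. -/
def orbit0 (u : ℕ → Bool) : Set (ℕ → Bool) :=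
  {v | ∃ k : ℕ, u k = false ∧ v = fun i => u (i + k + 1)}

open Classical in
/-- The lexicographic supremum of a set of binary sequences (greedy construction);
`⊥ = 0̄` for the empty set. -/
noncomputable def lexSupSeq (S : Set (ℕ → Bool)) : ℕ → Bool
  | n => decide (∃ u ∈ S, (∀ i, i < n → u i = lexSupSeq S i) ∧ u n = true)
  termination_by n => n

open Classical in
/-- The lexicographic infimum of a set of binary sequences (greedy construction);
`⊤ = 1̄` for the empty set. -/
noncomputable def lexInfSeq (S : Set (ℕ → Bool)) : ℕ → Bool
  | n => decide (¬ ∃ u ∈ S, (∀ i, i < n → u i = lexInfSeq S i) ∧ u n = false)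
  termination_by n => n

/-- `sup O(u)`, the lexicographically largest limit of suffixes of `u`. -/
noncomputable def supO (u : ℕ → Bool) : ℕ → Bool := lexSupSeq (orbit u)
/-- `inf O(u)`. -/
noncomputable def infO (u : ℕ → Bool) : ℕ → Bool := lexInfSeq (orbit u)
/-- `sup₀(u)`, the supremum of the suffixes preceded by `0`. -/
noncomputable def sup0 (u : ℕ → Bool) : ℕ → Bool := lexSupSeq (orbit0 u)
/-- `inf₁(u)`, the infimum of the suffixes preceded by `1`. -/
noncomputable def inf1 (u : ℕ → Bool) : ℕ → Bool := lexInfSeq (orbit1 u)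

/-- Strict lexicographic order on infinite binary words. -/
def lexLt (u v : ℕ → Bool) : Prop := ∃ n, (∀ i, i < n → u i = v i) ∧ u n < v n
/-- Lexicographic order on infinite binary words. -/
def lexLe (u v : ℕ → Bool) : Prop := lexLt u v ∨ u = v

/-- `f_u(m)`: the unique `β ≥ 1` with `β·π_β(sup O(u)) = m`. -/
noncomputable def fVal (u : ℕ → Bool) (m : ℝ) : ℝ :=
  sInf {β : ℝ | 1 ≤ β ∧ β * piB β (supO u) = m}

/-- `g_u(m)`: the unique `β > 1` with `(β-1)(1+π_β(inf O(u))) = m`. -/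
noncomputable def gVal (u : ℕ → Bool) (m : ℝ) : ℝ :=
  sInf {β : ℝ | 1 < β ∧ (β - 1) * (1 + piB β (infO u)) = m}

/-- `μ_u`: the unique `m ∈ (1,2]` with `f_u(m) = g_u(m)`. -/
noncomputable def muVal (u : ℕ → Bool) : ℝ :=
  sInf {m : ℝ | 1 < m ∧ m ≤ 2 ∧ fVal u m = gVal u m}

/-- `u` contains at least two ones. -/
def TwoOnes (u : ℕ → Bool) : Prop := ∃ k l, k < l ∧ u k = true ∧ u l = true

/-- The substitution `L : 0 ↦ 0, 1 ↦ 01` (with `0 = false`, `1 = true`). -/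
def Lsub : Bool → List Bool := fun b => if b then [false, true] else [false]
/-- The substitution `M : 0 ↦ 01, 1 ↦ 10`. -/
def Msub : Bool → List Bool := fun b => if b then [true, false] else [false, true]
/-- The substitution `R : 0 ↦ 01, 1 ↦ 1`. -/
def Rsub : Bool → List Bool := fun b => if b then [true] else [false, true]
/-- The identity substitution. -/
def idSub : Bool → List Bool := fun b => [b]
/-- Composition of substitutions: `compSub σ τ = σ ∘ τ` (apply `τ` first). -/
def compSub (σ τ : Bool → List Bool) : Bool → List Bool := fun b => (τ b).flatMap σ

/-- The monoid `{L,M,R}*` generated by the three substitutions. -/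
def LMRstar : Set (Bool → List Bool) :=
  {σ | ∃ l : List (Bool → List Bool),
    (∀ τ ∈ l, τ = Lsub ∨ τ = Msub ∨ τ = Rsub) ∧ σ = l.foldr compSub idSub}

/-- A substitution applied to an infinite word, `σ(u₁)σ(u₂)⋯`. -/
noncomputable def substApply (σ : Bool → List Bool) (u : ℕ → Bool) : ℕ → Bool := fun n =>
  let k := sSup {k : ℕ | (∑ i ∈ Finset.range k, (σ (u i)).length) ≤ n}
  (σ (u k)).getD (n - ∑ i ∈ Finset.range k, (σ (u i)).length) false

/-- `u` is a limit word of the sequence of substitutions `σseq`. -/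
def IsLimitWord (σseq : ℕ → Bool → List Bool) (u : ℕ → Bool) : Prop :=
  ∃ useq : ℕ → ℕ → Bool, useq 0 = u ∧ ∀ n, useq n = substApply (σseq n) (useq (n + 1))

/-- Primitivity of a sequence of substitutions in `{L,M,R}^ℕ`: no tail is constantly `L`
and no tail is constantly `R`. -/
def PrimitiveSeq (σseq : ℕ → Bool → List Bool) : Prop :=
  (¬ ∃ k, ∀ n, k ≤ n → σseq n = Lsub) ∧ ¬ ∃ k, ∀ n, k ≤ n → σseq n = Rsub

/-- `S_{L,M,R}`: the set of limit words of primitive sequences of substitutions. -/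
def Sset : Set (ℕ → Bool) :=
  {u | ∃ σseq : ℕ → Bool → List Bool,
    (∀ n, σseq n = Lsub ∨ σseq n = Msub ∨ σseq n = Rsub) ∧
    PrimitiveSeq σseq ∧ IsLimitWord σseq u}

/-- The word `1 0̄ = 1000⋯`. -/
def w10bar : ℕ → Bool := fun n => decide (n = 0)
/-- The word `0 1̄ = 0111⋯`. -/
def w01bar : ℕ → Bool := fun n => decide (n ≠ 0)
/-- The word `01 0̄ = 01000⋯`. -/
def w010bar : ℕ → Bool := fun n => decide (n = 1)
/-- The word `10 1̄ = 10111⋯`. -/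
def w101bar : ℕ → Bool := fun n => decide (n ≠ 1)
/-- The word `0̄`. -/
def w0bar : ℕ → Bool := fun _ => false
/-- The word `1̄`. -/
def w1bar : ℕ → Bool := fun _ => true

/-- Prepend a letter to an infinite word. -/
def consB (b : Bool) (u : ℕ → Bool) : ℕ → Bool := fun n =>
  match n with
  | 0 => b
  | Nat.succ k => u k

/-- Prepend a finite word to an infinite word. -/
def appendW (w : List Bool) (v : ℕ → Bool) : ℕ → Bool := fun n =>
  if n < w.length then w.getD n false else v (n - w.length)

/-- A substitution is nonerasing if it maps every letter to a nonempty word. -/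
def Nonerasing (σ : Bool → List Bool) : Prop := ∀ b, 0 < (σ b).length

theorem eq_consB (v : ℕ → Bool) : v = consB (v 0) (fun i => v (i + 1)) := by
  funext n
  cases n <;> rfl

theorem exists_eq_consB (v : ℕ → Bool) : ∃ b x, v = consB b x := ⟨_, _, eq_consB v⟩

theorem consB_injective (b : Bool) : Function.Injective (consB b) := fun _ _ h =>
  funext fun n => congrFun h (n + 1)

theorem appendW_nil (v : ℕ → Bool) : appendW [] v = v := by
  funext n
  simp [appendW]

theorem appendW_cons (b : Bool) (w : List Bool) (v : ℕ → Bool) :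
    appendW (b :: w) v = consB b (appendW w v) := by
  funext n
  cases n <;> simp [appendW, consB]

theorem appendW_append (w₁ w₂ : List Bool) (v : ℕ → Bool) :
    appendW (w₁ ++ w₂) v = appendW w₁ (appendW w₂ v) := by
  induction w₁ with
  | nil => simp [appendW_nil]
  | cons b w ih => simp [appendW_cons, ih]

/-! ### Substitutions on infinite words -/

theorem substApply_eq_getD {σ : Bool → List Bool} {u : ℕ → Bool} {n k : ℕ}
    (h₁ : ∑ i ∈ Finset.range k, (σ (u i)).length ≤ n)
    (h₂ : n < ∑ i ∈ Finset.range (k + 1), (σ (u i)).length) :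
    substApply σ u n =
      (σ (u k)).getD (n - ∑ i ∈ Finset.range k, (σ (u i)).length) false := by
  have hk : sSup {k : ℕ | ∑ i ∈ Finset.range k, (σ (u i)).length ≤ n} = k := by
    refine IsGreatest.csSup_eq ⟨h₁, fun j hj => ?_⟩
    by_contra! hlt
    have hmono : ∑ i ∈ Finset.range (k + 1), (σ (u i)).length ≤
        ∑ i ∈ Finset.range j, (σ (u i)).length :=
      Finset.sum_le_sum_of_subset (Finset.range_subset_range.2 hlt)
    simp only [Set.mem_ofPred_eq] at hj
    omega
  simp only [substApply, hk]

theorem Nonerasing.exists_block {σ : Bool → List Bool} (hσ : Nonerasing σ) (u : ℕ → Bool)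
    (n : ℕ) : ∃ k, ∑ i ∈ Finset.range k, (σ (u i)).length ≤ n ∧
      n < ∑ i ∈ Finset.range (k + 1), (σ (u i)).length := by
  have hex : ∃ k, n < ∑ i ∈ Finset.range (k + 1), (σ (u i)).length := by
    refine ⟨n, ?_⟩
    calc n < ∑ _i ∈ Finset.range (n + 1), 1 := by simp
      _ ≤ _ := Finset.sum_le_sum fun i _ => hσ (u i)
  classical
  refine ⟨Nat.find hex, ?_, Nat.find_spec hex⟩
  rcases hk : Nat.find hex with _ | k
  · simp
  · exact not_lt.1 (Nat.find_min hex (m := k) (by omega))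

theorem substApply_consB {σ : Bool → List Bool} (hσ : Nonerasing σ) (b : Bool) (u : ℕ → Bool) :
    substApply σ (consB b u) = appendW (σ b) (substApply σ u) := by
  have hsum : ∀ k, ∑ i ∈ Finset.range (k + 1), (σ (consB b u i)).length =
      (∑ i ∈ Finset.range k, (σ (u i)).length) + (σ b).length := fun k => by
    rw [Finset.sum_range_succ']
    rfl
  funext n
  by_cases hn : n < (σ b).length
  · rw [substApply_eq_getD (k := 0) (by simp) (by rw [hsum]; simpa using hn)]
    simp [appendW, hn, consB]
  · obtain ⟨k, hk₁, hk₂⟩ := hσ.exists_block u (n - (σ b).length)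
    rw [substApply_eq_getD (k := k + 1) (by rw [hsum]; omega) (by rw [hsum]; omega), hsum]
    simp only [appendW, hn, if_false]
    rw [substApply_eq_getD hk₁ hk₂, Nat.sub_sub, Nat.add_comm (σ b).length]
    rfl

theorem substApply_appendW {σ : Bool → List Bool} (hσ : Nonerasing σ) (w : List Bool)
    (u : ℕ → Bool) :
    substApply σ (appendW w u) = appendW (w.flatMap σ) (substApply σ u) := by
  induction w with
  | nil => simp [appendW_nil]
  | cons b w ih =>
    rw [appendW_cons, substApply_consB hσ, ih, List.flatMap_cons, appendW_append]

theorem Nonerasing.comp {σ τ : Bool → List Bool} (hσ : Nonerasing σ) (hτ : Nonerasing τ) :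
    Nonerasing (compSub σ τ) := fun b => by
  obtain ⟨a, l, hl⟩ := List.exists_cons_of_length_pos (hτ b)
  have := hσ a
  simp only [compSub, hl, List.flatMap_cons, List.length_append]
  omega

theorem appendW_agree {w : List Bool} (hw : 0 < w.length) {n : ℕ} {x y : ℕ → Bool}
    (h : ∀ i < n, x i = y i) : ∀ i < n + 1, appendW w x i = appendW w y i := by
  intro i hi
  simp only [appendW]
  split_ifs with hlt
  · rfl
  · exact h _ (by omega)

theorem substApply_compSub {σ τ : Bool → List Bool} (hσ : Nonerasing σ) (hτ : Nonerasing τ)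
    (u : ℕ → Bool) : substApply (compSub σ τ) u = substApply σ (substApply τ u) := by
  have key : ∀ n, ∀ u : ℕ → Bool, ∀ i < n,
      substApply (compSub σ τ) u i = substApply σ (substApply τ u) i := by
    intro n
    induction n with
    | zero => intro u i hi; omega
    | succ n ih =>
      intro u
      obtain ⟨b, x, rfl⟩ := exists_eq_consB u
      rw [substApply_consB (hσ.comp hτ), substApply_consB hτ, substApply_appendW hσ]
      exact appendW_agree (hσ.comp hτ b) (ih x)
  exact funext fun i => key (i + 1) u i i.lt_succ_self

theorem substApply_agree {σ : Bool → List Bool} (hσ : Nonerasing σ) {n : ℕ} {x y : ℕ → Bool}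
    (h : ∀ i < n, x i = y i) : ∀ i < n, substApply σ x i = substApply σ y i := by
  induction n generalizing x y with
  | zero => intro i hi; omega
  | succ n ih =>
    rw [eq_consB x, eq_consB y, h 0 n.succ_pos, substApply_consB hσ, substApply_consB hσ]
    exact appendW_agree (hσ _) (ih fun i hi => h (i + 1) (by omega))

theorem compSub_assoc (ρ σ τ : Bool → List Bool) :
    compSub (compSub ρ σ) τ = compSub ρ (compSub σ τ) := by
  funext b
  simp only [compSub, List.flatMap_assoc]
  rfl

theorem idSub_compSub (σ : Bool → List Bool) : compSub idSub σ = σ := by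
  funext b
  exact List.flatMap_singleton' (σ b)

theorem nonerasing_Lsub : Nonerasing Lsub := by intro b; cases b <;> simp [Lsub]

theorem nonerasing_Msub : Nonerasing Msub := by intro b; cases b <;> simp [Msub]

theorem nonerasing_Rsub : Nonerasing Rsub := by intro b; cases b <;> simp [Rsub]

section letters

variable (x : ℕ → Bool)

theorem Lsub_false : substApply Lsub (consB false x) = consB false (substApply Lsub x) := by
  simp [substApply_consB nonerasing_Lsub, Lsub, appendW_cons, appendW_nil]

theorem Lsub_true :
    substApply Lsub (consB true x) = consB false (consB true (substApply Lsub x)) := by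
  simp [substApply_consB nonerasing_Lsub, Lsub, appendW_cons, appendW_nil]

theorem Msub_false :
    substApply Msub (consB false x) = consB false (consB true (substApply Msub x)) := by
  simp [substApply_consB nonerasing_Msub, Msub, appendW_cons, appendW_nil]

theorem Msub_true :
    substApply Msub (consB true x) = consB true (consB false (substApply Msub x)) := by
  simp [substApply_consB nonerasing_Msub, Msub, appendW_cons, appendW_nil]

theorem Rsub_false :
    substApply Rsub (consB false x) = consB false (consB true (substApply Rsub x)) := by
  simp [substApply_consB nonerasing_Rsub, Rsub, appendW_cons, appendW_nil]

theorem Rsub_true : substApply Rsub (consB true x) = consB true (substApply Rsub x) := by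
  simp [substApply_consB nonerasing_Rsub, Rsub, appendW_cons, appendW_nil]

theorem exists_substApply_Lsub_eq : ∃ y, substApply Lsub x = consB false y := by
  obtain ⟨b, x, rfl⟩ := exists_eq_consB x
  cases b
  · exact ⟨_, Lsub_false x⟩
  · exact ⟨_, Lsub_true x⟩

end letters

/-! ### The lexicographic order -/

theorem lexLe_refl (x : ℕ → Bool) : lexLe x x := Or.inr rfl

theorem lexLt_false_true (x y : ℕ → Bool) : lexLt (consB false x) (consB true y) :=
  ⟨0, by simp, by simp [consB]⟩

theorem lexLe_false_true (x y : ℕ → Bool) : lexLe (consB false x) (consB true y) :=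
  Or.inl (lexLt_false_true x y)

theorem lexLt_consB {b : Bool} {x y : ℕ → Bool} (h : lexLt x y) :
    lexLt (consB b x) (consB b y) := by
  obtain ⟨n, h₁, h₂⟩ := h
  refine ⟨n + 1, fun i hi => ?_, h₂⟩
  cases i with
  | zero => rfl
  | succ i => exact h₁ i (by omega)

theorem lexLe_consB {b : Bool} {x y : ℕ → Bool} (h : lexLe x y) :
    lexLe (consB b x) (consB b y) :=
  h.imp lexLt_consB (congrArg _)

theorem lexLe_of_consB {b : Bool} {x y : ℕ → Bool} (h : lexLe (consB b x) (consB b y)) :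
    lexLe x y := by
  rcases h with ⟨n, h₁, h₂⟩ | h
  · cases n with
    | zero => simp [consB] at h₂
    | succ n => exact Or.inl ⟨n, fun i hi => h₁ (i + 1) (by omega), h₂⟩
  · exact Or.inr (consB_injective b h)

theorem not_lexLe_true_false (x y : ℕ → Bool) : ¬ lexLe (consB true x) (consB false y) := by
  rintro (⟨n, h₁, h₂⟩ | h)
  · cases n with
    | zero => exact absurd (show true < false from h₂) (by decide)
    | succ n => simpa [consB] using h₁ 0 n.succ_pos
  · simpa [consB] using congrFun h 0

theorem lexLt_appendW (w : List Bool) {x y : ℕ → Bool} (h : lexLt x y) :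
    lexLt (appendW w x) (appendW w y) := by
  induction w with
  | nil => simpa [appendW_nil] using h
  | cons b w ih => simpa [appendW_cons] using lexLt_consB ih

theorem substApply_lexLe {σ : Bool → List Bool} (hσ : Nonerasing σ)
    (h01 : ∀ x y, lexLt (substApply σ (consB false x)) (substApply σ (consB true y)))
    {x y : ℕ → Bool} (h : lexLe x y) : lexLe (substApply σ x) (substApply σ y) := by
  rcases h with ⟨n, h₁, h₂⟩ | rfl
  · left
    induction n generalizing x y with
    | zero =>
      rw [Bool.lt_iff] at h₂
      rw [eq_consB x, eq_consB y, h₂.1, h₂.2]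
      exact h01 _ _
    | succ n ih =>
      rw [eq_consB x, eq_consB y, h₁ 0 n.succ_pos, substApply_consB hσ, substApply_consB hσ]
      exact lexLt_appendW _ (ih (fun i hi => h₁ (i + 1) (by omega)) h₂)
  · exact lexLe_refl _

theorem Lsub_lexLe {x y : ℕ → Bool} (h : lexLe x y) :
    lexLe (substApply Lsub x) (substApply Lsub y) := by
  refine substApply_lexLe nonerasing_Lsub (fun x y => ?_) h
  obtain ⟨z, hz⟩ := exists_substApply_Lsub_eq x
  rw [Lsub_false, Lsub_true, hz]
  exact lexLt_consB (lexLt_false_true _ _)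

theorem Msub_lexLe {x y : ℕ → Bool} (h : lexLe x y) :
    lexLe (substApply Msub x) (substApply Msub y) := by
  refine substApply_lexLe nonerasing_Msub (fun x y => ?_) h
  rw [Msub_false, Msub_true]
  exact lexLt_false_true _ _

theorem Rsub_lexLe {x y : ℕ → Bool} (h : lexLe x y) :
    lexLe (substApply Rsub x) (substApply Rsub y) := by
  refine substApply_lexLe nonerasing_Rsub (fun x y => ?_) h
  rw [Rsub_false, Rsub_true]
  exact lexLt_false_true _ _

/-! ### Lexicographic suprema -/

theorem lexSupSeq_eq_true_iff {S : Set (ℕ → Bool)} {n : ℕ} :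
    lexSupSeq S n = true ↔ ∃ u ∈ S, (∀ i < n, u i = lexSupSeq S i) ∧ u n = true := by
  rw [lexSupSeq]
  simp

theorem lexSupSeq_approx {S : Set (ℕ → Bool)} (hS : S.Nonempty) (n : ℕ) :
    ∃ x ∈ S, ∀ i < n, x i = lexSupSeq S i := by
  induction n with
  | zero => exact hS.imp fun x hx => ⟨hx, by simp⟩
  | succ n ih =>
    cases hn : lexSupSeq S n with
    | true =>
      obtain ⟨x, hx, h₁, h₂⟩ := lexSupSeq_eq_true_iff.1 hn
      exact ⟨x, hx, Nat.forall_lt_succ_right.2 ⟨h₁, h₂.trans hn.symm⟩⟩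
    | false =>
      obtain ⟨x, hx, h₁⟩ := ih
      refine ⟨x, hx, Nat.forall_lt_succ_right.2 ⟨h₁, ?_⟩⟩
      rw [hn, ← Bool.not_eq_true]
      intro hxn
      rw [lexSupSeq_eq_true_iff.2 ⟨x, hx, h₁, hxn⟩] at hn
      cases hn

theorem exists_first_ne {x y : ℕ → Bool} (h : x ≠ y) :
    ∃ n, (∀ i < n, x i = y i) ∧ x n ≠ y n := by
  classical
  have hex := Function.ne_iff.1 h
  exact ⟨Nat.find hex, fun i hi => not_not.1 (Nat.find_min hex hi), Nat.find_spec hex⟩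

theorem le_lexSupSeq {S : Set (ℕ → Bool)} {x : ℕ → Bool} (hx : x ∈ S) :
    lexLe x (lexSupSeq S) := by
  by_cases h : x = lexSupSeq S
  · exact Or.inr h
  · obtain ⟨n, h₁, h₂⟩ := exists_first_ne h
    refine Or.inl ⟨n, h₁, ?_⟩
    rw [Bool.lt_iff]
    cases hxn : x n with
    | true => exact absurd (hxn.trans (lexSupSeq_eq_true_iff.2 ⟨x, hx, h₁, hxn⟩).symm) h₂
    | false => simpa [hxn] using h₂

theorem lexSupSeq_eq {S : Set (ℕ → Bool)} {s : ℕ → Bool} (h₁ : ∀ x ∈ S, lexLe x s)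
    (h₂ : ∀ n, ∃ x ∈ S, ∀ i < n, x i = s i) : lexSupSeq S = s := by
  funext n
  induction n using Nat.strong_induction_on with
  | _ n ih =>
    rw [Bool.eq_iff_iff, lexSupSeq_eq_true_iff]
    constructor
    · rintro ⟨x, hx, hagree, hxn⟩
      rcases h₁ x hx with ⟨m, hm₁, hm₂⟩ | rfl
      · rw [Bool.lt_iff] at hm₂
        rcases lt_trichotomy m n with hmn | rfl | hmn
        · have := (hagree m hmn).trans (ih m hmn)
          simp [hm₂] at this
        · simp [hm₂] at hxn
        · exact (hm₁ n hmn).symm.trans hxn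
      · exact hxn
    · intro hs
      obtain ⟨x, hx, hagree⟩ := h₂ (n + 1)
      exact ⟨x, hx, fun i hi => (hagree i (by omega)).trans (ih i hi).symm,
        (hagree n n.lt_succ_self).trans hs⟩

/-! ### Words whose orbit supremum is approached by suffixes preceded by `0` -/

/-- `s` is both the supremum of the orbit of `v` and that of the suffixes preceded by `0`. -/
structure IsCommonSup (v s : ℕ → Bool) : Prop where
  le : ∀ k, lexLe (fun i => v (i + k)) s
  approx : ∀ n, ∃ k, v k = false ∧ ∀ i < n, v (i + k + 1) = s i

theorem IsCommonSup.supO_eq {v s : ℕ → Bool} (h : IsCommonSup v s) : supO v = s := by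
  refine lexSupSeq_eq ?_ fun n => ?_
  · rintro _ ⟨k, rfl⟩
    exact h.le k
  · obtain ⟨k, -, hk⟩ := h.approx n
    exact ⟨_, ⟨k + 1, rfl⟩, hk⟩

theorem IsCommonSup.sup0_eq {v s : ℕ → Bool} (h : IsCommonSup v s) : sup0 v = s := by
  refine lexSupSeq_eq ?_ fun n => ?_
  · rintro _ ⟨k, -, rfl⟩
    exact h.le (k + 1)
  · obtain ⟨k, hk₀, hk⟩ := h.approx n
    exact ⟨_, ⟨k, hk₀, rfl⟩, hk⟩

theorem isCommonSup_supO {u : ℕ → Bool} (h : supO u = sup0 u) : IsCommonSup u (supO u) := by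
  have hne : (orbit0 u).Nonempty := by
    by_contra hemp
    rw [Set.not_nonempty_iff_eq_empty] at hemp
    have hu : u 0 = true := by
      rw [← Bool.not_eq_false]
      intro h0
      exact hemp.subset ⟨0, h0, rfl⟩
    have h₁ : supO u 0 = true := lexSupSeq_eq_true_iff.2 ⟨u, ⟨0, rfl⟩, by simp, hu⟩
    rw [h, sup0, hemp, lexSupSeq_eq_true_iff] at h₁
    simp at h₁
  refine ⟨fun k => le_lexSupSeq ⟨k, rfl⟩, fun n => ?_⟩
  obtain ⟨_, ⟨k, hk, rfl⟩, hx⟩ := lexSupSeq_approx hne n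
  exact ⟨k, hk, by rw [h]; exact hx⟩

theorem IsCommonSup.eq_consB_false {v s y : ℕ → Bool} (h : IsCommonSup v s)
    (hs : s = consB false y) : y = s := by
  have hv : ∀ k, v k = false := fun k => by
    rw [← Bool.not_eq_true]
    intro hk
    have hle := h.le k
    rw [eq_consB fun i => v (i + k), hs] at hle
    simp only [Nat.zero_add, hk] at hle
    exact not_lexLe_true_false _ _ hle
  have h0 : ∀ n, s n = false := fun n => by
    obtain ⟨k, -, hk⟩ := h.approx (n + 1)
    rw [← hk n n.lt_succ_self, hv]
  funext n
  rw [h0, ← h0 (n + 1), hs]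
  rfl

theorem orbit0_consB {b : Bool} {x v : ℕ → Bool} (h : x ∈ orbit0 v) :
    x ∈ orbit0 (consB b v) := by
  obtain ⟨k, hk, rfl⟩ := h
  exact ⟨k + 1, hk, rfl⟩

theorem mem_orbit0_consB_false (x : ℕ → Bool) : x ∈ orbit0 (consB false x) := ⟨0, rfl, rfl⟩

/-- Let `Q` be a property of words inherited by tails. If, for every word with property `Q`, the
suffixes of its image that start inside the image of the first letter have property `P`, then so
do all suffixes of its image. -/
theorem substApply_suffix_induction {σ : Bool → List Bool} (hσ : Nonerasing σ)
    {Q P : (ℕ → Bool) → Prop} (hQ : ∀ b x, Q (consB b x) → Q x)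
    (hP : ∀ b x, Q (consB b x) → ∀ k < (σ b).length,
      P fun i => substApply σ (consB b x) (i + k))
    {v : ℕ → Bool} (hv : Q v) (k : ℕ) : P fun i => substApply σ v (i + k) := by
  induction k using Nat.strong_induction_on generalizing v with
  | _ k ih =>
    obtain ⟨b, x, rfl⟩ := exists_eq_consB v
    by_cases hk : k < (σ b).length
    · exact hP b x hv k hk
    · have hpos := hσ b
      convert ih (k - (σ b).length) (by omega) (hQ b x hv) using 2 with i
      rw [substApply_consB hσ, appendW, if_neg (by omega)]
      congr 1
      omega

theorem suffixes_le_tail {s : ℕ → Bool} {b : Bool} {x : ℕ → Bool}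
    (h : ∀ k, lexLe (fun i => consB b x (i + k)) s) : ∀ k, lexLe (fun i => x (i + k)) s :=
  fun k => h (k + 1)

theorem IsCommonSup.substApply_Lsub {v s t : ℕ → Bool} (h : IsCommonSup v s)
    (ht : substApply Lsub s = consB false t) : IsCommonSup (substApply Lsub v) t := by
  have hle : ∀ x, lexLe x s → lexLe (substApply Lsub x) t := by
    intro x hx
    obtain ⟨b, y, rfl⟩ := exists_eq_consB s
    cases b
    · have := h.eq_consB_false rfl
      rw [Lsub_false, this] at ht
      exact consB_injective _ ht ▸ Lsub_lexLe hx
    · rw [Lsub_true] at ht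
      rw [← consB_injective _ ht]
      obtain ⟨z, hz⟩ := exists_substApply_Lsub_eq x
      rw [hz]
      exact lexLe_false_true _ _
  refine ⟨fun k => ?_, fun n => ?_⟩
  · refine substApply_suffix_induction nonerasing_Lsub
      (Q := fun x => ∀ k, lexLe (fun i => x (i + k)) s)
      (P := fun x => lexLe x t)
      (fun b x => suffixes_le_tail) (fun b x hx k hk => ?_) h.le k
    have hx0 : lexLe (consB b x) s := hx 0
    rcases k with _ | k
    · exact hle _ hx0
    · cases b
      · simp [Lsub] at hk
      · obtain rfl : k = 0 := by simpa [Lsub] using hk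
        have := Lsub_lexLe hx0
        rw [Lsub_true, ht] at this
        rw [Lsub_true]
        exact lexLe_of_consB this
  · obtain ⟨k, -, hk⟩ := h.approx (n + 1)
    have hmem : ∀ k, ∀ v : ℕ → Bool, ∀ z,
        substApply Lsub (fun i => v (i + k)) = consB false z →
        z ∈ orbit0 (substApply Lsub v) := by
      intro k
      induction k with
      | zero =>
        intro v z hz
        change substApply Lsub v = _ at hz
        rw [hz]
        exact mem_orbit0_consB_false z
      | succ k ih =>
        intro v z hz
        obtain ⟨b, x, rfl⟩ := exists_eq_consB v
        have := ih x z hz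
        cases b
        · rw [Lsub_false]
          exact orbit0_consB this
        · rw [Lsub_true]
          exact orbit0_consB (orbit0_consB this)
    obtain ⟨z, hz⟩ := exists_substApply_Lsub_eq fun i => v (i + (k + 1))
    obtain ⟨j, hj, rfl⟩ := hmem _ _ _ hz
    refine ⟨j, hj, fun i hi => ?_⟩
    have := substApply_agree nonerasing_Lsub hk (i + 1) (by omega)
    change substApply Lsub (fun i => v (i + (k + 1))) (i + 1) = _ at this
    rw [hz, ht] at this
    exact this

/-- If `σ(0) = 01`, then every suffix `x` of `v` preceded by `0` yields the suffix `1σ(x)` of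
`σ(v)`, again preceded by `0`. -/
theorem true_substApply_mem_orbit0 {σ : Bool → List Bool} (hσ : Nonerasing σ)
    (h0 : σ false = [false, true]) {k : ℕ} {v : ℕ → Bool} (hk : v k = false) :
    consB true (substApply σ fun i => v (i + k + 1)) ∈ orbit0 (substApply σ v) := by
  induction k generalizing v with
  | zero =>
    rw [eq_consB v, hk, substApply_consB hσ, h0, appendW_cons, appendW_cons, appendW_nil]
    exact mem_orbit0_consB_false _
  | succ k ih =>
    obtain ⟨b, x, rfl⟩ := exists_eq_consB v
    rw [substApply_consB hσ]
    have hmem := ih (v := x) hk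
    generalize σ b = w
    induction w with
    | nil => rwa [appendW_nil]
    | cons c w ihw =>
      rw [appendW_cons]
      exact orbit0_consB ihw

theorem IsCommonSup.approx_substApply {v s : ℕ → Bool} (h : IsCommonSup v s)
    {σ : Bool → List Bool} (hσ : Nonerasing σ) (h0 : σ false = [false, true]) (n : ℕ) :
    ∃ k, substApply σ v k = false ∧
      ∀ i < n, substApply σ v (i + k + 1) = consB true (substApply σ s) i := by
  obtain ⟨k, hk₀, hk⟩ := h.approx n
  obtain ⟨j, hj₀, hj⟩ := true_substApply_mem_orbit0 hσ h0 hk₀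
  refine ⟨j, hj₀, fun i hi => ?_⟩
  rw [← congrFun hj i]
  cases i with
  | zero => rfl
  | succ i => exact substApply_agree hσ hk i (by omega)

theorem IsCommonSup.substApply_Msub {v s : ℕ → Bool} (h : IsCommonSup v s) :
    IsCommonSup (substApply Msub v) (consB true (substApply Msub s)) := by
  refine ⟨fun k => ?_, h.approx_substApply nonerasing_Msub rfl⟩
  refine substApply_suffix_induction nonerasing_Msub
      (Q := fun x => ∀ k, lexLe (fun i => x (i + k)) s)
      (P := fun x => lexLe x _)
    (fun b x => suffixes_le_tail) (fun b x hx k hk => ?_) h.le k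
  have hx0 : lexLe (consB b x) s := hx 0
  have hx1 : lexLe x s := hx 1
  replace hk : k = 0 ∨ k = 1 := by cases b <;> simp [Msub] at hk <;> omega
  cases b
  · rw [Msub_false]
    rcases hk with rfl | rfl
    · exact lexLe_false_true _ _
    · exact lexLe_consB (Msub_lexLe hx1)
  · rw [Msub_true]
    rcases hk with rfl | rfl
    · obtain ⟨c, y, rfl⟩ := exists_eq_consB s
      cases c
      · exact absurd hx0 (not_lexLe_true_false _ _)
      · rw [Msub_true]
        exact lexLe_consB (lexLe_false_true _ _)
    · exact lexLe_false_true _ _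

theorem IsCommonSup.substApply_Rsub {v s : ℕ → Bool} (h : IsCommonSup v s) :
    IsCommonSup (substApply Rsub v) (consB true (substApply Rsub s)) := by
  refine ⟨fun k => ?_, h.approx_substApply nonerasing_Rsub rfl⟩
  refine substApply_suffix_induction nonerasing_Rsub
      (Q := fun x => ∀ k, lexLe (fun i => x (i + k)) s)
      (P := fun x => lexLe x _)
    (fun b x => suffixes_le_tail) (fun b x hx k hk => ?_) h.le k
  have hx1 : lexLe x s := hx 1
  cases b
  · replace hk : k = 0 ∨ k = 1 := by simp [Rsub] at hk; omega
    rw [Rsub_false]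
    rcases hk with rfl | rfl
    · exact lexLe_false_true _ _
    · exact lexLe_consB (Rsub_lexLe hx1)
  · obtain rfl : k = 0 := by simpa [Rsub] using hk
    rw [Rsub_true]
    exact lexLe_consB (Rsub_lexLe hx1)

/-! ### The prefix -/

/-- `p0` is a prefix of `σ(0̄)` and `σ` maps common suprema to common suprema preceded by `p0`. -/
structure HasSupPrefix (σ : Bool → List Bool) (p : List Bool) : Prop where
  nonerasing : Nonerasing σ
  isPrefix : ∃ z, substApply σ w0bar = appendW p (consB false z)
  isCommonSup : ∀ u s, IsCommonSup u s →
    ∃ t, IsCommonSup (substApply σ u) t ∧ substApply σ s = appendW p (consB false t)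

theorem hasSupPrefix_Lsub : HasSupPrefix Lsub [] := by
  refine ⟨nonerasing_Lsub, ?_, fun u s h => ?_⟩
  · simpa only [appendW_nil] using exists_substApply_Lsub_eq w0bar
  · obtain ⟨t, ht⟩ := exists_substApply_Lsub_eq s
    exact ⟨t, h.substApply_Lsub ht, by rw [appendW_nil, ht]⟩

theorem HasSupPrefix.comp_Lsub {σ : Bool → List Bool} {p : List Bool}
    (h : HasSupPrefix σ p) : HasSupPrefix (compSub Lsub σ) (p.flatMap Lsub ++ [false]) := by
  have hcomp := substApply_compSub nonerasing_Lsub h.nonerasing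
  refine ⟨nonerasing_Lsub.comp h.nonerasing, ?_, fun u s hs => ?_⟩
  · obtain ⟨z, hz⟩ := h.isPrefix
    obtain ⟨y, hy⟩ := exists_substApply_Lsub_eq z
    refine ⟨y, ?_⟩
    rw [hcomp, hz, substApply_appendW nonerasing_Lsub, Lsub_false, hy, appendW_append,
      appendW_cons, appendW_nil]
  · obtain ⟨t, ht, hst⟩ := h.isCommonSup u s hs
    obtain ⟨y, hy⟩ := exists_substApply_Lsub_eq t
    refine ⟨y, hcomp u ▸ ht.substApply_Lsub hy, ?_⟩
    rw [hcomp, hst, substApply_appendW nonerasing_Lsub, Lsub_false, hy, appendW_append,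
      appendW_cons, appendW_nil]

theorem HasSupPrefix.comp {σ τ : Bool → List Bool} {p : List Bool} (h : HasSupPrefix σ p)
    (hτ : Nonerasing τ) (h0 : τ false = [false, true])
    (hsup : ∀ {v s}, IsCommonSup v s →
      IsCommonSup (substApply τ v) (consB true (substApply τ s))) :
    HasSupPrefix (compSub τ σ) (p.flatMap τ) := by
  have hcomp := substApply_compSub hτ h.nonerasing
  refine ⟨hτ.comp h.nonerasing, ?_, fun u s hs => ?_⟩
  · obtain ⟨z, hz⟩ := h.isPrefix
    refine ⟨consB true (substApply τ z), ?_⟩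
    rw [hcomp, hz, substApply_appendW hτ, substApply_consB hτ, h0, appendW_cons, appendW_cons,
      appendW_nil]
  · obtain ⟨t, ht, hst⟩ := h.isCommonSup u s hs
    refine ⟨_, hcomp u ▸ hsup ht, ?_⟩
    rw [hcomp, hst, substApply_appendW hτ, substApply_consB hτ, h0, appendW_cons, appendW_cons,
      appendW_nil]

theorem exists_hasSupPrefix (l : List (Bool → List Bool))
    (hl : ∀ τ ∈ l, τ = Lsub ∨ τ = Msub ∨ τ = Rsub) :
    ∃ p, HasSupPrefix (compSub (l.foldr compSub idSub) Lsub) p := by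
  induction l with
  | nil => exact ⟨[], by simpa only [List.foldr_nil, idSub_compSub] using hasSupPrefix_Lsub⟩
  | cons τ l ih =>
    rw [List.forall_mem_cons] at hl
    obtain ⟨p, hp⟩ := ih hl.2
    rw [List.foldr_cons, compSub_assoc]
    rcases hl.1 with rfl | rfl | rfl
    · exact ⟨_, hp.comp_Lsub⟩
    · exact ⟨_, hp.comp nonerasing_Msub rfl IsCommonSup.substApply_Msub⟩
    · exact ⟨_, hp.comp nonerasing_Rsub rfl IsCommonSup.substApply_Rsub⟩

/-- For each `σ ∈ {L,M,R}*L` there is a finite prefix `w` of `σ(0̄)` with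
`w·sup₀(σ(u)) = w·sup O(σ(u)) = σ(sup O(u))` whenever `sup O(u) = sup₀(u)`. -/
theorem sup_subst_prefix (σ : Bool → List Bool) (hσ : ∃ τ ∈ LMRstar, σ = compSub τ Lsub) :
    ∃ w : List Bool, (∀ i < w.length, w.getD i false = substApply σ w0bar i) ∧
      ∀ u : ℕ → Bool, supO u = sup0 u →
        appendW w (sup0 (substApply σ u)) = substApply σ (supO u) ∧
        appendW w (supO (substApply σ u)) = substApply σ (supO u) := by
  obtain ⟨τ, ⟨l, hl, rfl⟩, rfl⟩ := hσ
  obtain ⟨p, hp⟩ := exists_hasSupPrefix l hl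
  refine ⟨p ++ [false], fun i hi => ?_, fun u hu => ?_⟩
  · obtain ⟨z, hz⟩ := hp.isPrefix
    have hw : appendW p (consB false z) = appendW (p ++ [false]) z := by
      rw [appendW_append, appendW_cons, appendW_nil]
    rw [hz, hw, appendW, if_pos hi]
  · obtain ⟨t, ht, hst⟩ := hp.isCommonSup u _ (isCommonSup_supO hu)
    rw [ht.sup0_eq, ht.supO_eq, hst, appendW_append, appendW_cons, appendW_nil]
    exact ⟨rfl, rfl⟩
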